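/- arXiv:math/0605112 — 2 statements merged into one kernel-verified Lean document; each statement's English description precedes it below -/
import Mathlib

section
/- Let C be a preadditive category with a zero object that has all ℕ-indexed products and coproducts. Let A be an object of C. If the canonical morphism from the coproduct ∐_{n∈ℕ} A (of countably many copies of A) to the product ∏_{n∈ℕ} A is an isomorphism, then the identity morphism of A is zero, i.e., A is a zero object. -/
open CategoryTheory CategoryTheory.Limits

universe v u

variable (C : Type u) [Category.{v} C]

variable [HasZeroMorphisms C] [HasCoproductsOfShape ℕ C] [HasProductsOfShape ℕ C]

/-- The canonical morphism from the coproduct to the product of a family `A`,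
whose `(k, l)` component is the identity of `A_k` if `k = l` and zero otherwise. -/
noncomputable def canonicalHom (A : ℕ → C) : (∐ A) ⟶ ∏ᶜ A :=
  Limits.Sigma.desc fun k => Limits.Pi.lift fun l =>
    if h : k = l then eqToHom (congrArg A h) else 0

/-- If `C` is preadditive with a zero object and the canonical morphism from the coproduct
`∐_{n ∈ ℕ} A` of countably many copies of `A` to the product `∏_{n ∈ ℕ} A` is an isomorphism,
then the identity of `A` is zero, i.e. `A` is a zero object. -/
theorem id_eq_zero_of_isIso_canonicalHom [Preadditive C] [HasZeroObject C] (A : C)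
    (h : IsIso (canonicalHom C (fun _ : ℕ => A))) :
    𝟙 A = 0 := by
  obtain rfl : ‹HasZeroMorphisms C› = Preadditive.preadditiveHasZeroMorphisms :=
    Subsingleton.elim _ _
  let F := canonicalHom C (fun _ : ℕ => A)
  let fold : (∐ fun _ : ℕ => A) ⟶ A := Limits.Sigma.desc fun _ => 𝟙 A
  let diag : A ⟶ ∏ᶜ fun _ : ℕ => A := Limits.Pi.lift fun _ => 𝟙 A
  let shiftCoprod : (∐ fun _ : ℕ => A) ⟶ ∐ fun _ : ℕ => A :=
    Limits.Sigma.desc fun k => Limits.Sigma.ι (fun _ : ℕ => A) (k + 1)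
  let shiftProd : (∏ᶜ fun _ : ℕ => A) ⟶ ∏ᶜ fun _ : ℕ => A :=
    Limits.Pi.lift fun l => Nat.casesOn l 0 fun k => Limits.Pi.π (fun _ : ℕ => A) k
  have shift_comm : F ≫ shiftProd = shiftCoprod ≫ F := by
    refine Limits.Sigma.hom_ext _ _ fun k => Limits.Pi.hom_ext _ _ fun l => ?_
    cases l <;> simp [F, shiftCoprod, shiftProd, canonicalHom]
  have shift_fold : shiftCoprod ≫ fold = fold := by
    refine Limits.Sigma.hom_ext _ _ fun k => ?_
    simp [shiftCoprod, fold]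
  have diag_eq : diag = diag ≫ shiftProd + Limits.Sigma.ι (fun _ : ℕ => A) 0 ≫ F := by
    refine Limits.Pi.hom_ext _ _ fun l => ?_
    cases l <;> simp [F, diag, shiftProd, canonicalHom]
  have : IsIso F := h
  have inv_shift : shiftProd ≫ inv F = inv F ≫ shiftCoprod := by
    rw [IsIso.comp_inv_eq, Category.assoc, ← shift_comm, IsIso.inv_hom_id_assoc]
  have key : diag ≫ inv F ≫ fold = diag ≫ inv F ≫ fold + 𝟙 A := by
    conv_lhs => rw [diag_eq]
    rw [Preadditive.add_comp, Category.assoc, Category.assoc, reassoc_of% inv_shift, shift_fold,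
      IsIso.hom_inv_id_assoc]
    simp [fold]
  exact left_eq_add.mp key
end

section
/- Let C be a preadditive category with a zero object that has all ℕ-indexed products and coproducts, and let A be an object of C. Suppose the canonical morphism Λ : ∐_{n∈ℕ} A → ∏_{n∈ℕ} A is an isomorphism with inverse Γ. Let Π : A → ∏_{n∈ℕ} A be the unique morphism with π_n ∘ Π = 1_A for all n, and let Σ : ∐_{n∈ℕ} A → A be the unique morphism with Σ ∘ ι_n = 1_A for all n. Then the endomorphism e := Σ ∘ Γ ∘ Π : A → A satisfies both e + e = e and 1_A + e = e. -/
open CategoryTheory CategoryTheory.Limits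

universe v u

variable (C : Type u) [Category.{v} C]

variable [HasZeroMorphisms C] [HasCoproductsOfShape ℕ C] [HasProductsOfShape ℕ C]

open Classical in
/-- The endomorphism of a countable power of `A` sending a family `x` to its extension by zero
along `σ : ℕ → ℕ`. -/
noncomputable def extendByZero (A : C) (σ : ℕ → ℕ) :
    (∏ᶜ fun _ : ℕ => A) ⟶ (∏ᶜ fun _ : ℕ => A) :=
  Limits.Pi.lift fun m =>
    if h : ∃ n, σ n = m then Limits.Pi.π (fun _ : ℕ => A) h.choose else 0

lemma extendByZero_π_apply (A : C) {σ : ℕ → ℕ} (hσ : Function.Injective σ) (n : ℕ) :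
    extendByZero C A σ ≫ Limits.Pi.π (fun _ : ℕ => A) (σ n) = Limits.Pi.π (fun _ : ℕ => A) n := by
  have h : ∃ k, σ k = σ n := ⟨n, rfl⟩
  rw [extendByZero, Limits.Pi.lift_π, dif_pos h, hσ h.choose_spec]

lemma extendByZero_π_of_notMem_range (A : C) {σ : ℕ → ℕ} {m : ℕ} (hm : ¬∃ n, σ n = m) :
    extendByZero C A σ ≫ Limits.Pi.π (fun _ : ℕ => A) m = 0 := by
  rw [extendByZero, Limits.Pi.lift_π, dif_neg hm]

lemma ι_canonicalHom_π (A : C) (n m : ℕ) :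
    Limits.Sigma.ι (fun _ : ℕ => A) n ≫ canonicalHom C (fun _ : ℕ => A) ≫
      Limits.Pi.π (fun _ : ℕ => A) m = if n = m then 𝟙 A else 0 := by
  simp [canonicalHom]

lemma canonicalHom_extendByZero (A : C) {σ : ℕ → ℕ} (hσ : Function.Injective σ) :
    canonicalHom C (fun _ : ℕ => A) ≫ extendByZero C A σ =
      Limits.Sigma.desc (fun n => Limits.Sigma.ι (fun _ : ℕ => A) (σ n)) ≫
        canonicalHom C (fun _ : ℕ => A) := by
  refine Limits.Sigma.hom_ext _ _ fun n => Limits.Pi.hom_ext _ _ fun m => ?_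
  simp only [Category.assoc, Limits.Sigma.ι_desc_assoc, ι_canonicalHom_π]
  by_cases hm : ∃ k, σ k = m
  · obtain ⟨k, rfl⟩ := hm
    simp only [extendByZero_π_apply C A hσ, ι_canonicalHom_π, hσ.eq_iff]
  · rw [extendByZero_π_of_notMem_range C A hm, if_neg fun h => hm ⟨n, h⟩]
    simp

/-- Summation of families indexed by `ℕ` is invariant under extension by zero along an
injection. -/
lemma extendByZero_comp_inv_comp_desc (A : C) {σ : ℕ → ℕ} (hσ : Function.Injective σ)
    {Γ : (∏ᶜ fun _ : ℕ => A) ⟶ (∐ fun _ : ℕ => A)}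
    (hΓ₁ : canonicalHom C (fun _ : ℕ => A) ≫ Γ = 𝟙 _)
    (hΓ₂ : Γ ≫ canonicalHom C (fun _ : ℕ => A) = 𝟙 _) :
    extendByZero C A σ ≫ Γ ≫ Limits.Sigma.desc (fun _ : ℕ => 𝟙 A) =
      Γ ≫ Limits.Sigma.desc (fun _ : ℕ => 𝟙 A) := by
  have h : extendByZero C A σ ≫ Γ =
      Γ ≫ Limits.Sigma.desc (fun n => Limits.Sigma.ι (fun _ : ℕ => A) (σ n)) := by
    calc extendByZero C A σ ≫ Γ
        = (Γ ≫ canonicalHom C (fun _ : ℕ => A)) ≫ extendByZero C A σ ≫ Γ := by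
          rw [hΓ₂, Category.id_comp]
      _ = Γ ≫ (canonicalHom C (fun _ : ℕ => A) ≫ extendByZero C A σ) ≫ Γ := by
          simp only [Category.assoc]
      _ = _ := by
          rw [canonicalHom_extendByZero C A hσ, Category.assoc, hΓ₁, Category.comp_id]
  rw [reassoc_of% h]
  congr 1
  refine Limits.Sigma.hom_ext _ _ fun n => ?_
  simp

/-- Let `C` be preadditive with a zero object and `ℕ`-indexed products and coproducts, and
suppose the canonical morphism `Λ : ∐_{n ∈ ℕ} A ⟶ ∏_{n ∈ ℕ} A` is an isomorphism with inverse
`Γ`. Let `Π : A ⟶ ∏_{n ∈ ℕ} A` be the morphism with all components the identity and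
`Σ : ∐_{n ∈ ℕ} A ⟶ A` the morphism with all cocomponents the identity. Then
`e = Σ ∘ Γ ∘ Π` satisfies `e + e = e` and `1_A + e = e`. -/
theorem comp_inv_canonical_idempotent_and_absorbing
    [Preadditive C] [HasZeroObject C] (A : C)
    (Γ : (∏ᶜ fun _ : ℕ => A) ⟶ (∐ fun _ : ℕ => A))
    (hΓ₁ : canonicalHom C (fun _ : ℕ => A) ≫ Γ = 𝟙 _)
    (hΓ₂ : Γ ≫ canonicalHom C (fun _ : ℕ => A) = 𝟙 _) :
    (Limits.Pi.lift (fun _ : ℕ => 𝟙 A) ≫ Γ ≫ Limits.Sigma.desc (fun _ : ℕ => 𝟙 A)) +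
        (Limits.Pi.lift (fun _ : ℕ => 𝟙 A) ≫ Γ ≫ Limits.Sigma.desc (fun _ : ℕ => 𝟙 A)) =
      (Limits.Pi.lift (fun _ : ℕ => 𝟙 A) ≫ Γ ≫ Limits.Sigma.desc (fun _ : ℕ => 𝟙 A)) ∧
    𝟙 A + (Limits.Pi.lift (fun _ : ℕ => 𝟙 A) ≫ Γ ≫ Limits.Sigma.desc (fun _ : ℕ => 𝟙 A)) =
      (Limits.Pi.lift (fun _ : ℕ => 𝟙 A) ≫ Γ ≫ Limits.Sigma.desc (fun _ : ℕ => 𝟙 A)) := by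
  obtain rfl : ‹HasZeroMorphisms C› = Preadditive.preadditiveHasZeroMorphisms :=
    Subsingleton.elim _ _
  have key {σ : ℕ → ℕ} (hσ : Function.Injective σ) :=
    congrArg (Limits.Pi.lift (fun _ : ℕ => 𝟙 A) ≫ ·)
      (extendByZero_comp_inv_comp_desc C A hσ hΓ₁ hΓ₂)
  have hEven : Function.Injective fun n : ℕ => 2 * n := fun a b h => by
    dsimp only at h; omega
  have hOdd : Function.Injective fun n : ℕ => 2 * n + 1 := fun a b h => by
    dsimp only at h; omega
  constructor
  · have split : Limits.Pi.lift (fun _ : ℕ => 𝟙 A) ≫ extendByZero C A (fun n => 2 * n) +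
        Limits.Pi.lift (fun _ : ℕ => 𝟙 A) ≫ extendByZero C A (fun n => 2 * n + 1) =
        Limits.Pi.lift (fun _ : ℕ => 𝟙 A) := by
      refine Limits.Pi.hom_ext _ _ fun m => ?_
      rw [Preadditive.add_comp, Category.assoc, Category.assoc]
      obtain ⟨k, rfl | rfl⟩ := Nat.even_or_odd' m
      · rw [extendByZero_π_apply C A hEven k,
          extendByZero_π_of_notMem_range C A (by rintro ⟨n, h⟩; omega)]
        simp
      · rw [extendByZero_π_apply C A hOdd k,
          extendByZero_π_of_notMem_range C A (by rintro ⟨n, h⟩; omega)]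
        simp
    conv_rhs => rw [← split]
    rw [Preadditive.add_comp, Category.assoc, Category.assoc]
    exact congrArg₂ (· + ·) (key hEven).symm (key hOdd).symm
  · have split : Limits.Sigma.ι (fun _ : ℕ => A) 0 ≫ canonicalHom C (fun _ : ℕ => A) +
        Limits.Pi.lift (fun _ : ℕ => 𝟙 A) ≫ extendByZero C A Nat.succ =
        Limits.Pi.lift (fun _ : ℕ => 𝟙 A) := by
      refine Limits.Pi.hom_ext _ _ fun m => ?_
      rw [Preadditive.add_comp, Category.assoc, Category.assoc, ι_canonicalHom_π]
      cases m with
      | zero =>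
        rw [extendByZero_π_of_notMem_range C A (by rintro ⟨n, h⟩; omega)]
        simp
      | succ k =>
        rw [extendByZero_π_apply C A Nat.succ_injective k]
        simp
    conv_rhs => rw [← split]
    rw [Preadditive.add_comp, Category.assoc, Category.assoc, reassoc_of% hΓ₁,
      Limits.Sigma.ι_desc]
    exact congrArg (𝟙 A + ·) (key Nat.succ_injective).symm
end
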